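/- arXiv:2510.19705 — 2 statements merged into one kernel-verified Lean document; each statement's English description precedes it below -/
import Mathlib

section
/- Let V be a finite nonempty set and let p, q be probability distributions on V with p ≠ q. Define β = Σ_{x∈V} min(p(x), q(x)) and the residual distribution r(x) = max(0, p(x) − q(x)) / Σ_{y∈V} max(0, p(y) − q(y)). Then for every x ∈ V, min(p(x), q(x)) + (1 − β)·r(x) = p(x). (Hence the speculative sampling rule — sample x ~ q, accept it with probability min(1, p(x)/q(x)), and on rejection resample from r — produces a token whose law is exactly p.) -/
/-- Speculative sampling correctness pointwise: for probability distributions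
`p ≠ q` on a finite nonempty set `V`, with `β = ∑ min (p x) (q x)` and residual
`r x = max 0 (p x - q x) / ∑ max 0 (p y - q y)`, we have
`min (p x) (q x) + (1 - β) * r x = p x` for every `x`. -/
theorem speculative_sampling_pointwise
    {V : Type*} [Fintype V] [Nonempty V]
    (p q : V → ℝ)
    (hp_nonneg : ∀ x, 0 ≤ p x) (hp_sum : ∑ x, p x = 1)
    (hq_nonneg : ∀ x, 0 ≤ q x) (hq_sum : ∑ x, q x = 1)
    (hpq : p ≠ q) :
    ∀ x : V,
      min (p x) (q x)
        + (1 - ∑ y, min (p y) (q y))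
          * (max 0 (p x - q x) / ∑ y, max 0 (p y - q y))
        = p x := by
  intro x
  have key : ∀ y, min (p y) (q y) + max 0 (p y - q y) = p y := by
    intro y
    rcases le_total (p y) (q y) with h | h
    · rw [min_eq_left h, max_eq_left (by linarith)]; ring
    · rw [min_eq_right h, max_eq_right (by linarith)]; ring
  have hS : 1 - ∑ y, min (p y) (q y) = ∑ y, max 0 (p y - q y) := by
    rw [← hp_sum, ← Finset.sum_sub_distrib]
    exact Finset.sum_congr rfl fun y _ => by linarith [key y]
  have hne : ∑ y, max 0 (p y - q y) ≠ 0 := by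
    intro h0
    have hz := (Finset.sum_eq_zero_iff_of_nonneg
      (fun y _ => le_max_left (0 : ℝ) (p y - q y))).1 h0
    have hle : ∀ y ∈ Finset.univ, p y ≤ q y := fun y hy => by
      linarith [hz y hy, le_max_right (0 : ℝ) (p y - q y)]
    have heq := (Finset.sum_eq_sum_iff_of_le hle).1 (hp_sum.trans hq_sum.symm)
    exact hpq (funext fun y => heq y (Finset.mem_univ y))
  rw [hS, mul_div_cancel₀ _ hne]
  exact key x
end

section
/- Let V be a finite nonempty set. For probability distributions q, p on V define the speculative correction kernel κ_{q,p} : V × V → ℝ by κ_{q,p}(x, y) = [x = y]·min(1, p(x)/q(x)) + (1 − min(1, p(x)/q(x)))·r(y) when q(x) > 0 and p ≠ q, where r(y) = max(0, p(y) − q(y)) / Σ_{z∈V} max(0, p(z) − q(z)); and κ_{q,p}(x, y) = [x = y] when p = q. Then pushing q forward through κ_{q,p} yields p: for every y ∈ V, Σ_{x∈V} q(x)·κ_{q,p}(x, y) = p(y). Consequently, for any chain of probability distributions p_0, p_1, …, p_K on V, sequentially pushing p_0 through κ_{p_0,p_1}, then κ_{p_1,p_2}, …, then κ_{p_{K−1},p_K}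 yields exactly p_K. (This is the single-token core of the correctness of Hierarchical Speculative Decoding: each level's verification rule converts a token distributed as the lower model's distribution into one distributed as its own, so the output of the full hierarchy follows the target model's distribution p_K.) -/
open Finset
open scoped Classical

/-- A probability distribution on a finite type `V`. -/
def IsDist {V : Type*} [Fintype V] (p : V → ℝ) : Prop :=
  (∀ x, 0 ≤ p x) ∧ ∑ x, p x = 1

/-- The speculative correction kernel `κ_{q,p}`: keep the drafted token `x` with
probability `min 1 (p x / q x)`, otherwise resample from the normalized positive
part of `p - q`; if `p = q`, keep the token. -/
noncomputable def specKernel {V : Type*} [Fintype V] (q p : V → ℝ) (x y : V) : ℝ :=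
  if p = q then (if x = y then 1 else 0)
  else (if x = y then 1 else 0) * min 1 (p x / q x)
    + (1 - min 1 (p x / q x)) * (max 0 (p y - q y) / ∑ z, max 0 (p z - q z))

theorem push_aux {V : Type*} [Fintype V] (q p : V → ℝ) (hq : IsDist q) (hp : IsDist p)
    (y : V) : ∑ x, q x * specKernel q p x y = p y := by
  by_cases h : p = q
  · subst h
    simp [specKernel]
  have hmin : ∀ x, q x * min 1 (p x / q x) = q x - max 0 (p x - q x) + (p x - q x) := by
    intro x
    rcases (hq.1 x).eq_or_lt with h0 | h0
    · have := hp.1 x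
      rw [← h0]
      simp [this]
    · rw [mul_min_of_nonneg _ _ h0.le, mul_div_cancel₀ _ h0.ne']
      rcases le_total (p x) (q x) with h1 | h1
      · rw [min_eq_right (by linarith), max_eq_left (by linarith)]; ring
      · rw [min_eq_left (by linarith), max_eq_right (by linarith)]; ring
  have hS : ∑ z, max 0 (p z - q z) ≠ 0 := by
    intro h0
    rw [Finset.sum_eq_zero_iff_of_nonneg (fun _ _ => le_max_left _ _)] at h0
    have hle : ∀ z, 0 ≤ q z - p z := fun z => by
      have h1 := h0 z (Finset.mem_univ z)
      have h2 := le_max_right 0 (p z - q z)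
      linarith
    have hs : ∑ z, (q z - p z) = 0 := by
      rw [Finset.sum_sub_distrib, hq.2, hp.2, sub_self]
    rw [Finset.sum_eq_zero_iff_of_nonneg (fun z _ => hle z)] at hs
    apply h
    funext z
    have := hs z (Finset.mem_univ z)
    linarith
  have hterm : ∀ x, q x * specKernel q p x y =
      (if x = y then q x - max 0 (p x - q x) + (p x - q x) else 0)
      + (max 0 (p x - q x) - (p x - q x)) *
        (max 0 (p y - q y) / ∑ z, max 0 (p z - q z)) := by
    intro x
    have hm := hmin x
    simp only [specKernel, if_neg h]
    split_ifs
    · linear_combination (1 - max 0 (p y - q y) / ∑ z, max 0 (p z - q z)) * hm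
    · linear_combination (- (max 0 (p y - q y) / ∑ z, max 0 (p z - q z))) * hm
  rw [Finset.sum_congr rfl (fun x _ => hterm x), Finset.sum_add_distrib, ← Finset.sum_mul,
    Finset.sum_sub_distrib, Finset.sum_sub_distrib, hp.2, hq.2, sub_self, sub_zero,
    mul_div_cancel₀ _ hS]
  simp

/-- Single-token correctness of (hierarchical) speculative decoding: the
speculative correction kernel pushes `q` forward to `p`, and hence sequentially
pushing `p_0` through the kernels `κ_{p_0,p_1}, …, κ_{p_{K-1},p_K}` yields
exactly `p_K`. -/
theorem specKernel_pushforward_and_chain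
    {V : Type*} [Fintype V] [Nonempty V] :
    (∀ q p : V → ℝ, IsDist q → IsDist p →
      ∀ y : V, ∑ x, q x * specKernel q p x y = p y) ∧
    (∀ (K : ℕ) (ps : ℕ → V → ℝ), (∀ i, IsDist (ps i)) →
      ∀ μ : ℕ → V → ℝ, μ 0 = ps 0 →
        (∀ i, μ (i + 1) = fun y => ∑ x, μ i x * specKernel (ps i) (ps (i + 1)) x y) →
        μ K = ps K) := by
  refine ⟨push_aux, ?_⟩
  intro K ps hps μ h0 hs
  induction K with
  | zero => exact h0
  | succ k ih =>
    rw [hs k, ih]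
    funext y
    exact push_aux _ _ (hps k) (hps (k + 1)) y
end
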